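/- arXiv:1708.09064 — 2 statements merged into one kernel-verified Lean document; each statement's English description precedes it below -/
import Mathlib

section
/- Let n ≥ 1 be an integer. A polynomial p ∈ ℚ[X,Y,Z] of total degree at most n satisfies p(l,i,j) = 0 for all integers l, i, j ≥ 0 with l + i + j < n if and only if p lies in the ℚ-linear span of the polynomials [X]_{n−i−j}·[Y]_i·[Z]_j for integers i, j ≥ 0 with i + j ≤ n. -/
open MvPolynomial

/-- The product of the falling factorials `[X k]_{t k}` over all variables `X k`. -/
noncomputable def fallingMonomial {σ : Type*} [Fintype σ] (t : σ → ℕ) : MvPolynomial σ ℚ :=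
  ∏ k, Polynomial.aeval (X k) (descPochhammer ℚ (t k))

theorem eval_fallingMonomial {σ : Type*} [Fintype σ] (t a : σ → ℕ) :
    eval (fun k => (a k : ℚ)) (fallingMonomial t) = ∏ k, ((a k).descFactorial (t k) : ℚ) := by
  rw [fallingMonomial, map_prod]
  refine Finset.prod_congr rfl fun k _ => ?_
  rw [← descPochhammer_eval_eq_descFactorial, ← coe_aeval_eq_eval]
  change aeval _ _ = _
  rw [← Polynomial.aeval_algHom_apply, aeval_X, Polynomial.coe_aeval_eq_eval]

theorem X_mul_fallingMonomial {σ : Type*} [Fintype σ] [DecidableEq σ] (t : σ → ℕ) (k : σ) :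
    X k * fallingMonomial t =
      fallingMonomial (Function.update t k (t k + 1)) + (t k : ℚ) • fallingMonomial t := by
  have h : ∏ j ∈ Finset.univ.erase k, Polynomial.aeval (X j : MvPolynomial σ ℚ)
        (descPochhammer ℚ (Function.update t k (t k + 1) j)) =
      ∏ j ∈ Finset.univ.erase k, Polynomial.aeval (X j) (descPochhammer ℚ (t j)) :=
    Finset.prod_congr rfl fun j hj => by
      rw [Function.update_of_ne (Finset.ne_of_mem_erase hj)]
  simp only [fallingMonomial]
  rw [← Finset.mul_prod_erase _ _ (Finset.mem_univ k), ← Finset.mul_prod_erase _ _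
    (Finset.mem_univ k), h, Function.update_self, descPochhammer_succ_right, smul_eq_C_mul]
  simp only [map_mul, map_sub, Polynomial.aeval_X, map_natCast]
  ring

/-- The span of the products of falling factorials of total degree at most `N`. -/
noncomputable def fallingSpan (σ : Type*) [Fintype σ] (N : ℕ) : Submodule ℚ (MvPolynomial σ ℚ) :=
  Submodule.span ℚ (fallingMonomial '' {t : σ → ℕ | ∑ k, t k ≤ N})

theorem fallingSpan_mono {σ : Type*} [Fintype σ] {M N : ℕ} (h : M ≤ N) :
    fallingSpan σ M ≤ fallingSpan σ N :=
  Submodule.span_mono (Set.image_mono fun _ ht => le_trans ht h)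

theorem X_mul_mem_fallingSpan {σ : Type*} [Fintype σ] {N : ℕ} {q : MvPolynomial σ ℚ}
    (hq : q ∈ fallingSpan σ N) (k : σ) : X k * q ∈ fallingSpan σ (N + 1) := by
  classical
  induction hq using Submodule.span_induction with
  | mem q h =>
    obtain ⟨t, ht, rfl⟩ := h
    rw [Set.mem_ofPred_eq] at ht
    rw [X_mul_fallingMonomial]
    refine add_mem (Submodule.subset_span ⟨_, ?_, rfl⟩)
      (Submodule.smul_mem _ _ (Submodule.subset_span ⟨t, ?_, rfl⟩))
    · rw [Set.mem_ofPred_eq, Finset.sum_update_of_mem (Finset.mem_univ k)]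
      rw [← Finset.add_sum_erase _ _ (Finset.mem_univ k), Finset.erase_eq] at ht
      omega
    · exact Nat.le_succ_of_le ht
  | zero => simp
  | add x y _ _ hx hy => rw [mul_add]; exact add_mem hx hy
  | smul c x _ hx => rw [mul_smul_comm]; exact Submodule.smul_mem _ _ hx

theorem X_pow_mul_mem_fallingSpan {σ : Type*} [Fintype σ] {N : ℕ} {q : MvPolynomial σ ℚ}
    (hq : q ∈ fallingSpan σ N) (k : σ) (e : ℕ) : X k ^ e * q ∈ fallingSpan σ (N + e) := by
  induction e with
  | zero => simpa using hq
  | succ e ih =>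
    rw [pow_succ', mul_assoc]
    exact X_mul_mem_fallingSpan ih k

theorem prod_X_pow_mem_fallingSpan {σ : Type*} [Fintype σ] (m : σ → ℕ) (s : Finset σ) :
    ∏ k ∈ s, (X k : MvPolynomial σ ℚ) ^ m k ∈ fallingSpan σ (∑ k ∈ s, m k) := by
  classical
  induction s using Finset.induction_on with
  | empty => exact Submodule.subset_span ⟨0, by simp, by simp [fallingMonomial]⟩
  | insert k s hk ih =>
    rw [Finset.prod_insert hk, Finset.sum_insert hk, add_comm]
    exact X_pow_mul_mem_fallingSpan ih k _

theorem mem_fallingSpan_of_totalDegree_le {σ : Type*} [Fintype σ] {N : ℕ} {p : MvPolynomial σ ℚ}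
    (hp : p.totalDegree ≤ N) : p ∈ fallingSpan σ N := by
  rw [p.as_sum]
  refine Submodule.sum_mem _ fun m hm => ?_
  rw [monomial_eq, ← smul_eq_C_mul]
  refine Submodule.smul_mem _ _ (fallingSpan_mono ?_ (prod_X_pow_mem_fallingSpan m m.support))
  exact (le_totalDegree hm).trans hp

theorem coeff_eq_zero_of_eval_eq_zero {σ : Type*} [Fintype σ] {n : ℕ} (c : (σ → ℕ) →₀ ℚ)
    (h : ∀ a : σ → ℕ, ∑ k, a k < n →
      eval (fun k => (a k : ℚ)) (Finsupp.linearCombination ℚ fallingMonomial c) = 0)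
    (a : σ → ℕ) (ha : ∑ k, a k < n) : c a = 0 := by
  classical
  induction hN : ∑ k, a k using Nat.strong_induction_on generalizing a with
  | _ N ih =>
    subst hN
    have key := h a ha
    rw [Finsupp.linearCombination_apply, Finsupp.sum, map_sum, Finset.sum_eq_single a] at key
    · rw [smul_eval, eval_fallingMonomial] at key
      refine (mul_eq_zero.mp key).resolve_right (Finset.prod_ne_zero_iff.mpr fun k _ => ?_)
      rw [Nat.descFactorial_self]
      exact_mod_cast (a k).factorial_ne_zero
    · intro b _ hb
      rw [smul_eval, eval_fallingMonomial]
      by_cases hba : b ≤ a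
      · have hlt : ∑ k, b k < ∑ k, a k := Finset.sum_lt_sum (fun k _ => hba k) (by
          by_contra! hge
          exact hb (le_antisymm hba fun k => hge k (Finset.mem_univ k)))
        rw [ih _ hlt b (hlt.trans ha) rfl, zero_mul]
      · obtain ⟨k, hk⟩ := not_forall.mp hba
        rw [Finset.prod_eq_zero (Finset.mem_univ k), mul_zero]
        exact_mod_cast Nat.descFactorial_of_lt (not_le.mp hk)
    · intro hna
      rw [Finsupp.notMem_support_iff.mp hna, zero_smul, map_zero]

/-- A polynomial of total degree at most `n` vanishes at all natural points with coordinate sum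
less than `n` iff it is a combination of products of falling factorials of degree exactly `n`. -/
theorem forall_eval_eq_zero_iff_mem_span_fallingMonomial {σ : Type*} [Fintype σ] {n : ℕ}
    {p : MvPolynomial σ ℚ} (hp : p.totalDegree ≤ n) :
    (∀ a : σ → ℕ, ∑ k, a k < n → eval (fun k => (a k : ℚ)) p = 0) ↔
      p ∈ Submodule.span ℚ (fallingMonomial '' {t : σ → ℕ | ∑ k, t k = n}) := by
  constructor
  · intro h
    have hmem := mem_fallingSpan_of_totalDegree_le hp
    rw [fallingSpan, Finsupp.mem_span_image_iff_linearCombination] at hmem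
    obtain ⟨c, hc, rfl⟩ := hmem
    rw [Finsupp.mem_span_image_iff_linearCombination]
    refine ⟨c, fun t ht => ?_, rfl⟩
    refine le_antisymm (hc ht) (not_lt.mp fun hlt => ?_)
    exact Finsupp.mem_support_iff.mp ht (coeff_eq_zero_of_eval_eq_zero c h t hlt)
  · intro h a ha
    have hle : Submodule.span ℚ (fallingMonomial '' {t : σ → ℕ | ∑ k, t k = n}) ≤
        LinearMap.ker (aeval (fun k => (a k : ℚ))).toLinearMap := by
      rw [Submodule.span_le]
      rintro _ ⟨t, ht, rfl⟩
      rw [Set.mem_ofPred_eq] at ht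
      obtain ⟨k, -, hk⟩ := Finset.exists_lt_of_sum_lt (ha.trans_eq ht.symm)
      rw [SetLike.mem_coe, LinearMap.mem_ker, AlgHom.toLinearMap_apply, aeval_eq_eval,
        eval_fallingMonomial]
      exact Finset.prod_eq_zero (Finset.mem_univ k)
        (by exact_mod_cast Nat.descFactorial_of_lt hk)
    simpa [aeval_eq_eval] using hle h

/-- For `n ≥ 1`, a polynomial `p ∈ ℚ[X,Y,Z]` of total degree at most `n` vanishes at
all `(l,i,j)` with `l,i,j ≥ 0`, `l+i+j < n` if and only if `p` lies in the span of the
polynomials `[X]_{n−i−j}·[Y]_i·[Z]_j` for `i,j ≥ 0`, `i+j ≤ n`. -/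
theorem stmt7 (n : ℕ) (hn : 1 ≤ n) (p : MvPolynomial (Fin 3) ℚ)
    (hp : p.totalDegree ≤ n) :
    (∀ l i j : ℕ, l + i + j < n → eval ![(l : ℚ), (i : ℚ), (j : ℚ)] p = 0) ↔
      p ∈ Submodule.span ℚ ((fun ij : ℕ × ℕ =>
        Polynomial.aeval (X 0) (descPochhammer ℚ (n - ij.1 - ij.2)) *
        Polynomial.aeval (X 1) (descPochhammer ℚ ij.1) *
        Polynomial.aeval (X 2) (descPochhammer ℚ ij.2)) '' {ij : ℕ × ℕ | ij.1 + ij.2 ≤ n}) := by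
  have hset : (fun ij : ℕ × ℕ =>
        Polynomial.aeval (X 0 : MvPolynomial (Fin 3) ℚ) (descPochhammer ℚ (n - ij.1 - ij.2)) *
        Polynomial.aeval (X 1) (descPochhammer ℚ ij.1) *
        Polynomial.aeval (X 2) (descPochhammer ℚ ij.2)) '' {ij : ℕ × ℕ | ij.1 + ij.2 ≤ n} =
      fallingMonomial '' {t : Fin 3 → ℕ | ∑ k, t k = n} := by
    ext q
    simp only [fallingMonomial, Fin.sum_univ_three, Fin.prod_univ_three, Set.mem_image,
      Set.mem_ofPred_eq]
    constructor
    · rintro ⟨⟨i, j⟩, hij, rfl⟩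
      refine ⟨![n - i - j, i, j], ?_, rfl⟩
      change n - i - j + i + j = n
      dsimp only at hij
      omega
    · rintro ⟨t, ht, rfl⟩
      refine ⟨(t 1, t 2), by dsimp only; omega, ?_⟩
      rw [show n - (t 1, t 2).1 - (t 1, t 2).2 = t 0 by dsimp only; omega]
  rw [hset, ← forall_eval_eq_zero_iff_mem_span_fallingMonomial hp]
  have hvec (a : Fin 3 → ℕ) : ![(a 0 : ℚ), (a 1 : ℚ), (a 2 : ℚ)] = fun k => (a k : ℚ) := by
    ext k
    fin_cases k <;> rfl
  constructor
  · intro h a ha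
    rw [← hvec]
    exact h _ _ _ (by rwa [Fin.sum_univ_three] at ha)
  · intro h l i j hlt
    have := h ![l, i, j] (by rwa [Fin.sum_univ_three])
    rwa [← hvec] at this
end

section
/- Let n ≥ 1 and A ≥ 1 be integers, let c_{ij} ∈ ℚ for integers i, j ≥ 0 with i + j ≤ n, and let p(X,Y,Z) = Σ_{i+j≤n} c_{ij}·[X]_{n−i−j}·[Y]_i·[Z]_j ∈ ℚ[X,Y,Z]. Then in ℚ[Y,Z] the identity A·p(−A−1, Y, Z) = (A + n − Y − Z)·p(−A, Y, Z) + Y·p(−A, Y−1, Z) + Z·p(−A, Y, Z−1) holds. -/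
/-- `t * [t - 1]_k = (t - k) * [t]_k` for falling factorials in an `R`-algebra. -/
theorem mul_aeval_sub_one_descPochhammer {R S : Type*} [CommRing R] [CommRing S] [Algebra R S]
    (t : S) (k : ℕ) :
    t * Polynomial.aeval (t - 1) (descPochhammer R k) =
      (t - k) * Polynomial.aeval t (descPochhammer R k) := by
  have h := congrArg (Polynomial.aeval t)
    ((descPochhammer_succ_left R k).symm.trans (descPochhammer_succ_right R k))
  simp only [map_mul, map_sub, Polynomial.aeval_X, Polynomial.aeval_comp, map_one,
    map_natCast] at h
  rw [h, mul_comm]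

/-- For `n ≥ 1`, `A ≥ 1`, rationals `c_{ij}` (`i,j ≥ 0`, `i+j ≤ n`) and
`p(X,Y,Z) = Σ_{i+j≤n} c_{ij}·[X]_{n−i−j}·[Y]_i·[Z]_j ∈ ℚ[X,Y,Z]`, we have in `ℚ[Y,Z]`:
`A·p(−A−1,Y,Z) = (A+n−Y−Z)·p(−A,Y,Z) + Y·p(−A,Y−1,Z) + Z·p(−A,Y,Z−1)`. -/
theorem stmt9 (n : ℕ) (hn : 1 ≤ n) (A : ℤ) (hA : 1 ≤ A) (c : ℕ × ℕ → ℚ)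
    (p : MvPolynomial (Fin 3) ℚ)
    (hp : p = ∑ i ∈ Finset.range (n + 1), ∑ j ∈ Finset.range (n + 1 - i),
      MvPolynomial.C (c (i, j)) *
        (Polynomial.aeval (MvPolynomial.X 0) (descPochhammer ℚ (n - i - j)) *
         Polynomial.aeval (MvPolynomial.X 1) (descPochhammer ℚ i) *
         Polynomial.aeval (MvPolynomial.X 2) (descPochhammer ℚ j))) :
    MvPolynomial.C (A : ℚ) *
        MvPolynomial.aeval
          ![MvPolynomial.C (-(A : ℚ) - 1), MvPolynomial.X 0, MvPolynomial.X 1] p =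
      (MvPolynomial.C ((A : ℚ) + (n : ℚ)) - MvPolynomial.X 0 - MvPolynomial.X 1) *
          MvPolynomial.aeval
            ![MvPolynomial.C (-(A : ℚ)), MvPolynomial.X 0, MvPolynomial.X 1] p +
        MvPolynomial.X 0 *
          MvPolynomial.aeval
            ![MvPolynomial.C (-(A : ℚ)), MvPolynomial.X 0 - 1, MvPolynomial.X 1] p +
        MvPolynomial.X 1 *
          MvPolynomial.aeval
            ![MvPolynomial.C (-(A : ℚ)), MvPolynomial.X 0, MvPolynomial.X 1 - 1] p := by
  subst hp
  simp only [map_sum, Finset.mul_sum, ← Finset.sum_add_distrib]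
  refine Finset.sum_congr rfl fun i hi => Finset.sum_congr rfl fun j hj => ?_
  obtain ⟨k, rfl⟩ : ∃ k, n = i + j + k :=
    Nat.exists_eq_add_of_le (by simp only [Finset.mem_range] at hi hj; omega)
  simp only [show i + j + k - i - j = k by omega, map_mul, ← Polynomial.aeval_algHom_apply,
    MvPolynomial.aeval_X, MvPolynomial.aeval_C, Matrix.cons_val, map_add, map_sub, map_neg,
    map_one, map_natCast, Nat.cast_add]
  have hx := mul_aeval_sub_one_descPochhammer (R := ℚ)
    (-MvPolynomial.C (A : ℚ) : MvPolynomial ℕ ℚ) k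
  have hy := mul_aeval_sub_one_descPochhammer (R := ℚ) (MvPolynomial.X 0 : MvPolynomial ℕ ℚ) i
  have hz := mul_aeval_sub_one_descPochhammer (R := ℚ) (MvPolynomial.X 1 : MvPolynomial ℕ ℚ) j
  generalize algebraMap ℚ (MvPolynomial ℕ ℚ) (c (i, j)) = d
  set x := Polynomial.aeval (-MvPolynomial.C (A : ℚ) : MvPolynomial ℕ ℚ) (descPochhammer ℚ k)
  set y := Polynomial.aeval (MvPolynomial.X 0 : MvPolynomial ℕ ℚ) (descPochhammer ℚ i)
  set z := Polynomial.aeval (MvPolynomial.X 1 : MvPolynomial ℕ ℚ) (descPochhammer ℚ j)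
  linear_combination (-d * y * z) * hx - (d * x * z) * hy - (d * x * y) * hz
end
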